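/- arXiv:1406.5934 — 2 statements merged into one kernel-verified Lean document; each statement's English description precedes it below -/
import Mathlib

section
/- Let β = (0,β₂,...,βₙ) with |β| ≥ 1, and suppose f_β(z) = Σ_{k≥0} a_k z₁ᵏ z^β belongs to the Drury–Arveson space H²ₙ. Then z₂·(1-z₁²)^{-1/4}·f_β belongs to H²ₙ and ‖z₂(1-z₁²)^{-1/4} f_β‖²_{H²ₙ} ≤ 2‖f_β‖²_{H²ₙ}. -/
open Metric Nat Finset

/-- The degree `|α|` of a multi-index. -/
def mdeg {n : ℕ} (α : Fin n →₀ ℕ) : ℕ := α.sum fun _ m => m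

/-- The factorial `α! = α₁!⋯αₙ!` of a multi-index. -/
def mfact {n : ℕ} (α : Fin n →₀ ℕ) : ℕ := α.prod fun _ m => m !

/-- The Drury–Arveson weight: the squared `H²ₙ`-norm of the monomial `z^α`
is `α!/|α|!`. -/
noncomputable def daWeight {n : ℕ} (α : Fin n →₀ ℕ) : ℝ :=
  (mfact α : ℝ) / ((mdeg α)! : ℝ)

/-- The monomial `z^α = z₁^{α₁} ⋯ zₙ^{αₙ}`. -/
def mon {n : ℕ} (α : Fin n →₀ ℕ) (z : EuclideanSpace ℂ (Fin n)) : ℂ :=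
  ∏ i, z i ^ α i

/-- `a` is the monomial-coefficient (Taylor) expansion of `f` on the unit ball. -/
def IsExpansion {n : ℕ} (a : (Fin n →₀ ℕ) → ℂ) (f : EuclideanSpace ℂ (Fin n) → ℂ) :
    Prop :=
  ∀ z ∈ ball (0 : EuclideanSpace ℂ (Fin n)) 1, HasSum (fun α => a α * mon α z) (f z)

/-- Membership in the Drury–Arveson space `H²ₙ`, expressed via coefficients:
`Σ_α |a_α|² α!/|α|! < ∞`. -/
def MemDA {n : ℕ} (a : (Fin n →₀ ℕ) → ℂ) : Prop :=
  Summable fun α => ‖a α‖ ^ 2 * daWeight α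

/-- The squared Drury–Arveson norm, via coefficients. -/
noncomputable def daNormSq {n : ℕ} (a : (Fin n →₀ ℕ) → ℂ) : ℝ :=
  ∑' α, ‖a α‖ ^ 2 * daWeight α

/-- The Drury–Arveson inner product, via coefficients. -/
noncomputable def daInner {n : ℕ} (a b : (Fin n →₀ ℕ) → ℂ) : ℂ :=
  ∑' α, (starRingEnd ℂ) (a α) * b α * (daWeight α : ℂ)

/-- the coefficients of `(1-x)^{-1/4}` -/
noncomputable def dcoef (j : ℕ) : ℝ := Ring.multichoose (1 / 4 : ℝ) j

lemma dcoef_nonneg (j : ℕ) : 0 ≤ dcoef j := by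
  have h := Ring.factorial_nsmul_multichoose_eq_ascPochhammer (1 / 4 : ℝ) j
  rw [Polynomial.ascPochhammer_smeval_eq_eval, nsmul_eq_mul] at h
  have h2 : 0 < (ascPochhammer ℝ j).eval (1 / 4 : ℝ) := ascPochhammer_pos j _ (by norm_num)
  rw [← h] at h2
  exact (pos_of_mul_pos_right h2 (by positivity)).le

lemma dcoef_hasSum (x : ℂ) (hx : ‖x‖ < 1) :
    HasSum (fun j => (dcoef j : ℂ) * x ^ j) ((1 - x) ^ (-(1 / 4) : ℂ)) := by
  have h := (Complex.one_div_one_sub_cpow_hasFPowerSeriesOnBall_zero (1 / 4)).hasSum (y := x)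
    (by simpa [enorm_eq_nnnorm, ← NNReal.coe_lt_coe] using hx)
  have e : ∀ j, (dcoef j : ℂ) = Ring.choose ((1 / 4 : ℂ) + j - 1) j := by
    intro j
    rw [dcoef, Ring.multichoose_eq, Complex.ofReal_choose]
    push_cast
    rfl
  simp only [e, Complex.cpow_neg]
  simpa [FormalMultilinearSeries.ofScalars_apply_eq, mul_comm] using h

/-- coefficients of `(1-x^2)^{-1/4}` -/
noncomputable def ccoef (j : ℕ) : ℝ := if Even j then dcoef (j / 2) else 0

lemma ccoef_nonneg (j : ℕ) : 0 ≤ ccoef j := by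
  unfold ccoef
  split_ifs
  · exact dcoef_nonneg _
  · exact le_rfl

lemma ccoef_hasSum (x : ℂ) (hx : ‖x‖ < 1) :
    HasSum (fun j => (ccoef j : ℂ) * x ^ j) ((1 - x ^ 2) ^ (-(1 / 4) : ℂ)) := by
  have h := dcoef_hasSum (x ^ 2) (by rw [norm_pow]; exact pow_lt_one₀ (norm_nonneg _) hx (by norm_num))
  have hi : Function.Injective (fun j : ℕ => 2 * j) := fun a b h => by simpa using h
  refine (hi.hasSum_iff ?_).1 ?_
  · intro j hj
    have : ¬ Even j := fun ⟨k, hk⟩ => hj ⟨k, by simp only; omega⟩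
    simp [ccoef, this]
  · convert h using 2 with j
    simp [ccoef, pow_mul]

lemma ccoef_hasSum_real (t : ℝ) (h0 : 0 < t) (h1 : t < 1) :
    ∃ W : ℝ, HasSum (fun j => ccoef j * √t ^ j) W ∧ W ^ 2 * (1 - t) ≤ 1 := by
  have hs : √t < 1 := by rw [Real.sqrt_lt' one_pos]; simpa
  have h := ccoef_hasSum (√t : ℂ) (by simpa [abs_of_nonneg (Real.sqrt_nonneg t)] using hs)
  refine ⟨(1 - t) ^ (-(1 / 4) : ℝ), ?_, ?_⟩
  · rw [← Complex.hasSum_ofReal]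
    convert h using 1
    · simp
    · rw [Complex.ofReal_cpow (by linarith)]
      have : ((√t : ℝ) : ℂ) ^ 2 = t := by rw [← Complex.ofReal_pow, Real.sq_sqrt h0.le]
      rw [this]
      push_cast
      rfl
  · rw [← Real.rpow_natCast, ← Real.rpow_mul (by linarith)]
    nth_rw 2 [← Real.rpow_one (1 - t)]
    rw [← Real.rpow_add (by linarith)]
    exact Real.rpow_le_one (by linarith) (by linarith) (by norm_num)

/-- Cauchy-Schwarz for the Cauchy product -/
lemma cs_pointwise (c u : ℕ → ℝ) (hc : ∀ j, 0 ≤ c j) (t W : ℝ) (ht : 0 < t)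
    (hW : HasSum (fun j => c j * √t ^ j) W) (k : ℕ) :
    (∑ p ∈ Finset.HasAntidiagonal.antidiagonal k, c p.1 * u p.2) ^ 2 * t ^ k ≤
      W * ∑ p ∈ Finset.HasAntidiagonal.antidiagonal k, (c p.1 * √t ^ p.1) * (u p.2 ^ 2 * t ^ p.2) := by
  have hs : 0 ≤ √t := Real.sqrt_nonneg t
  have hst : √t ^ 2 = t := Real.sq_sqrt ht.le
  have e : (∑ p ∈ Finset.HasAntidiagonal.antidiagonal k, c p.1 * u p.2) ^ 2 * t ^ k =
      (∑ p ∈ Finset.HasAntidiagonal.antidiagonal k, (c p.1 * √t ^ p.1) * (u p.2 * √t ^ p.2)) ^ 2 := by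
    have hk : t ^ k = (√t ^ k) ^ 2 := by rw [← pow_mul, mul_comm k 2, pow_mul, hst]
    rw [hk, ← mul_pow, Finset.sum_mul]
    congr 1
    refine Finset.sum_congr rfl fun p hp => ?_
    rw [← Finset.HasAntidiagonal.mem_antidiagonal.1 hp, pow_add]
    ring
  rw [e]
  refine (Finset.sum_sq_le_sum_mul_sum_of_sq_le_mul _
    (f := fun p => c p.1 * √t ^ p.1) (g := fun p => (c p.1 * √t ^ p.1) * (u p.2 ^ 2 * t ^ p.2))
    ?_ ?_ ?_).trans ?_
  · intro p _
    exact mul_nonneg (hc _) (by positivity)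
  · intro p _
    exact mul_nonneg (mul_nonneg (hc _) (by positivity)) (by positivity)
  · intro p _
    have hk : t ^ p.2 = (√t ^ p.2) ^ 2 := by rw [← pow_mul, mul_comm p.2 2, pow_mul, hst]
    rw [hk]
    exact le_of_eq (by ring)
  · refine mul_le_mul_of_nonneg_right ?_ ?_
    · rw [Finset.Nat.sum_antidiagonal_eq_sum_range_succ (fun i _ => c i * √t ^ i)]
      exact sum_le_hasSum _ (fun i _ => mul_nonneg (hc _) (by positivity)) hW
    · exact Finset.sum_nonneg fun p _ =>
        mul_nonneg (mul_nonneg (hc _) (by positivity)) (by positivity)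

lemma young_pointwise (c u : ℕ → ℝ) (hc : ∀ j, 0 ≤ c j) (t W : ℝ) (ht : 0 < t) (ht1 : t < 1)
    (hW : HasSum (fun j => c j * √t ^ j) W) (hW1 : W ^ 2 * (1 - t) ≤ 1) (m : ℕ) :
    ∑' k, ENNReal.ofReal ((∑ p ∈ Finset.HasAntidiagonal.antidiagonal k, c p.1 * u p.2) ^ 2 *
        (t ^ k * (1 - t) ^ (m + 1))) ≤
      ∑' k, ENNReal.ofReal (u k ^ 2 * (t ^ k * (1 - t) ^ m)) := by
  have h1t : 0 < 1 - t := by linarith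
  have hcs : ∀ j, 0 ≤ c j * √t ^ j := fun j => mul_nonneg (hc _) (by positivity)
  have hW0 : 0 ≤ W := hW.nonneg hcs
  have hu : ∀ j, 0 ≤ u j ^ 2 * (t ^ j * (1 - t) ^ m) := fun j => by positivity
  calc _ ≤ ∑' k, ENNReal.ofReal (W * (1 - t)) * ∑ p ∈ Finset.HasAntidiagonal.antidiagonal k,
        ENNReal.ofReal (c p.1 * √t ^ p.1) *
          ENNReal.ofReal (u p.2 ^ 2 * (t ^ p.2 * (1 - t) ^ m)) := by
        refine ENNReal.tsum_le_tsum fun k => ?_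
        have := cs_pointwise c u hc t W ht hW k
        simp_rw [← ENNReal.ofReal_mul (hcs _)]
        rw [← ENNReal.ofReal_sum_of_nonneg (fun p _ => mul_nonneg (hcs _) (hu _)),
          ← ENNReal.ofReal_mul (by positivity)]
        refine ENNReal.ofReal_le_ofReal ?_
        calc _ = ((∑ p ∈ Finset.HasAntidiagonal.antidiagonal k, c p.1 * u p.2) ^ 2 * t ^ k) * (1 - t) ^ (m + 1) := by
              ring
          _ ≤ _ := mul_le_mul_of_nonneg_right this (by positivity)
          _ = _ := by
            rw [Finset.mul_sum, Finset.sum_mul, Finset.mul_sum]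
            refine Finset.sum_congr rfl fun p _ => ?_
            ring
    _ = ENNReal.ofReal (W * (1 - t)) * ((∑' j, ENNReal.ofReal (c j * √t ^ j)) *
          ∑' k, ENNReal.ofReal (u k ^ 2 * (t ^ k * (1 - t) ^ m))) := by
        rw [ENNReal.tsum_mul_left]
        congr 1
        rw [← ENNReal.tsum_mul_right]
        simp_rw [← ENNReal.tsum_mul_left]
        rw [← ENNReal.tsum_prod (f := fun i j => ENNReal.ofReal (c i * √t ^ i) *
          ENNReal.ofReal (u j ^ 2 * (t ^ j * (1 - t) ^ m))),
          ← (Finset.HasAntidiagonal.sigmaAntidiagonalEquivProd (A := ℕ)).tsum_eq, ENNReal.tsum_sigma']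
        refine tsum_congr fun k => ?_
        rw [tsum_fintype, ← Finset.sum_coe_sort]
        rfl
    _ = ENNReal.ofReal (W ^ 2 * (1 - t)) *
          ∑' k, ENNReal.ofReal (u k ^ 2 * (t ^ k * (1 - t) ^ m)) := by
        rw [← ENNReal.ofReal_tsum_of_nonneg hcs hW.summable, hW.tsum_eq, ← mul_assoc,
          ← ENNReal.ofReal_mul (by positivity)]
        congr 2
        ring
    _ ≤ 1 * _ := by
        gcongr
        simpa using ENNReal.ofReal_le_ofReal hW1
    _ = _ := one_mul _

lemma beta_lintegral (k m : ℕ) :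
    ∫⁻ t in Set.Ioo (0 : ℝ) 1, ENNReal.ofReal (t ^ k * (1 - t) ^ m) =
      ENNReal.ofReal ((k.factorial * m.factorial : ℝ) / (k + m + 1).factorial) := by
  have hb := Complex.betaIntegral_eq_Gamma_mul_div (k + 1 : ℂ) (m + 1 : ℂ)
    (by simp; positivity) (by simp; positivity)
  have e1 : Complex.betaIntegral (k + 1 : ℂ) (m + 1 : ℂ) =
      ((∫ t in (0 : ℝ)..1, t ^ k * (1 - t) ^ m : ℝ) : ℂ) := by
    rw [Complex.betaIntegral, ← intervalIntegral.integral_ofReal]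
    refine intervalIntegral.integral_congr fun t _ => ?_
    simp
  have e2 : (k + 1 + (m + 1) : ℂ) = ((k + m + 1 : ℕ) : ℂ) + 1 := by push_cast; ring
  rw [e1, e2, Complex.Gamma_nat_eq_factorial, Complex.Gamma_nat_eq_factorial,
    Complex.Gamma_nat_eq_factorial] at hb
  have hb' : (∫ t in (0 : ℝ)..1, t ^ k * (1 - t) ^ m : ℝ) =
      (k.factorial * m.factorial : ℝ) / (k + m + 1).factorial := by
    apply Complex.ofReal_injective
    rw [hb]
    push_cast
    rfl
  rw [← hb', intervalIntegral.integral_of_le zero_le_one,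
    MeasureTheory.integral_Ioc_eq_integral_Ioo,
    MeasureTheory.ofReal_integral_eq_lintegral_ofReal]
  · have : Continuous fun t : ℝ => t ^ k * (1 - t) ^ m := by fun_prop
    exact (this.continuousOn.integrableOn_Icc (a := 0) (b := 1)).mono_set Set.Ioo_subset_Icc_self
  · refine (MeasureTheory.ae_restrict_iff' measurableSet_Ioo).2 (Filter.Eventually.of_forall ?_)
    intro t ht
    have : 0 < t := ht.1
    have : 0 < 1 - t := by linarith [ht.2]
    simp only [Pi.zero_apply]
    positivity

lemma lint_mul (r : ℝ) (hr : 0 ≤ r) (k m : ℕ) :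
    ∫⁻ t in Set.Ioo (0 : ℝ) 1, ENNReal.ofReal (r * (t ^ k * (1 - t) ^ m)) =
      ENNReal.ofReal (r * ((k.factorial * m.factorial : ℝ) / (k + m + 1).factorial)) := by
  simp_rw [ENNReal.ofReal_mul hr]
  rw [MeasureTheory.lintegral_const_mul _ (by fun_prop), beta_lintegral]

lemma core (u : ℕ → ℝ) (m : ℕ) :
    ∑' k, ENNReal.ofReal ((∑ p ∈ Finset.HasAntidiagonal.antidiagonal k, ccoef p.1 * u p.2) ^ 2 *
        ((k.factorial * (m + 1).factorial : ℝ) / (k + (m + 1) + 1).factorial)) ≤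
      ∑' k, ENNReal.ofReal (u k ^ 2 * ((k.factorial * m.factorial : ℝ) / (k + m + 1).factorial)) := by
  simp_rw [← lint_mul _ (sq_nonneg _)]
  rw [← MeasureTheory.lintegral_tsum (fun k => by fun_prop),
    ← MeasureTheory.lintegral_tsum (fun k => by fun_prop)]
  refine MeasureTheory.setLIntegral_mono' measurableSet_Ioo fun t ht => ?_
  obtain ⟨W, hW, hW1⟩ := ccoef_hasSum_real t ht.1 ht.2
  exact young_pointwise ccoef u ccoef_nonneg t W ht.1 ht.2 hW hW1 m

lemma core_real (u : ℕ → ℝ) (m : ℕ)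
    (hs : Summable fun k => u k ^ 2 * ((k.factorial * m.factorial : ℝ) / (k + m + 1).factorial)) :
    Summable (fun k => (∑ p ∈ Finset.HasAntidiagonal.antidiagonal k, ccoef p.1 * u p.2) ^ 2 *
        ((k.factorial * (m + 1).factorial : ℝ) / (k + (m + 1) + 1).factorial)) ∧
    ∑' k, (∑ p ∈ Finset.HasAntidiagonal.antidiagonal k, ccoef p.1 * u p.2) ^ 2 *
        ((k.factorial * (m + 1).factorial : ℝ) / (k + (m + 1) + 1).factorial) ≤
      ∑' k, u k ^ 2 * ((k.factorial * m.factorial : ℝ) / (k + m + 1).factorial) := by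
  have h := core u m
  have h1 : ∀ k, 0 ≤ (∑ p ∈ Finset.HasAntidiagonal.antidiagonal k, ccoef p.1 * u p.2) ^ 2 *
        ((k.factorial * (m + 1).factorial : ℝ) / (k + (m + 1) + 1).factorial) := fun k => by
    positivity
  have h2 : ∀ k, 0 ≤ u k ^ 2 * ((k.factorial * m.factorial : ℝ) / (k + m + 1).factorial) :=
    fun k => by positivity
  rw [← ENNReal.ofReal_tsum_of_nonneg h2 hs] at h
  have hs' : Summable (fun k => (∑ p ∈ Finset.HasAntidiagonal.antidiagonal k, ccoef p.1 * u p.2) ^ 2 *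
        ((k.factorial * (m + 1).factorial : ℝ) / (k + (m + 1) + 1).factorial)) := by
    have := ENNReal.summable_toReal (ne_top_of_le_ne_top ENNReal.ofReal_ne_top h)
    simpa only [ENNReal.toReal_ofReal (h1 _)] using this
  refine ⟨hs', ?_⟩
  rw [← ENNReal.ofReal_tsum_of_nonneg h1 hs'] at h
  exact (ENNReal.ofReal_le_ofReal_iff (tsum_nonneg h2)).1 h

lemma mon_add {n : ℕ} (α γ : Fin n →₀ ℕ) (z : EuclideanSpace ℂ (Fin n)) :
    mon (α + γ) z = mon α z * mon γ z := by
  simp [mon, pow_add, Finset.prod_mul_distrib]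

lemma mon_single {n : ℕ} (i : Fin n) (k : ℕ) (z : EuclideanSpace ℂ (Fin n)) :
    mon (Finsupp.single i k) z = z i ^ k := by
  rw [mon, Finset.prod_eq_single i]
  · simp
  · intro j _ hj
    simp [hj.symm]
  · simp

lemma mdeg_add_single {n : ℕ} (α : Fin n →₀ ℕ) (i : Fin n) (k : ℕ) :
    mdeg (α + Finsupp.single i k) = mdeg α + k := by
  unfold mdeg
  rw [Finsupp.sum_add_index' (fun _ => rfl) (fun _ _ _ => rfl), Finsupp.sum_single_index rfl]

lemma le_mdeg {n : ℕ} (α : Fin n →₀ ℕ) (i : Fin n) : α i ≤ mdeg α := by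
  unfold mdeg
  rw [Finsupp.sum_fintype _ _ (fun _ => rfl)]
  exact Finset.single_le_sum (f := fun i => α i) (fun _ _ => Nat.zero_le _) (Finset.mem_univ i)

lemma mfact_add_single {n : ℕ} (α : Fin n →₀ ℕ) (i : Fin n) (k : ℕ) :
    mfact (α + Finsupp.single i k) * (α i).factorial = (α i + k).factorial * mfact α := by
  unfold mfact
  rw [Finsupp.prod_fintype _ _ (fun _ => rfl), Finsupp.prod_fintype _ _ (fun _ => rfl),
    ← Finset.mul_prod_erase _ _ (Finset.mem_univ i),
    ← Finset.mul_prod_erase (a := i) _ (fun j => (α j).factorial) (Finset.mem_univ i)]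
  have : ∏ x ∈ Finset.univ.erase i, ((α + Finsupp.single i k) x).factorial =
      ∏ x ∈ Finset.univ.erase i, (α x).factorial := by
    refine Finset.prod_congr rfl fun j hj => ?_
    have := Finset.ne_of_mem_erase hj
    simp [this.symm]
  rw [this]
  simp
  ring

lemma daWeight_add_single {n : ℕ} (γ : Fin n →₀ ℕ) (i : Fin n) (hi : γ i = 0) (m : ℕ)
    (hm : mdeg γ = m + 1) (k : ℕ) :
    daWeight (γ + Finsupp.single i k) = (mfact γ : ℝ) / m.factorial *
      ((k.factorial * m.factorial : ℝ) / (k + m + 1).factorial) := by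
  have h := mfact_add_single γ i k
  rw [hi] at h
  simp only [Nat.factorial_zero, mul_one, zero_add] at h
  have h2 : m + 1 + k = k + m + 1 := by ring
  rw [daWeight, mdeg_add_single, hm, h, h2]
  have : (m.factorial : ℝ) ≠ 0 := by positivity
  push_cast
  field_simp

lemma extend_tools {n : ℕ} (γ : Fin n →₀ ℕ) (i : Fin n) :
    Function.Injective (fun k : ℕ => γ + Finsupp.single i k) := by
  intro a b h
  exact Finsupp.single_injective i (add_left_cancel h)

/-- Let `β = (0, β₂, …, βₙ)` with `|β| ≥ 1` and let `f_β(z) = Σ_k a_k z₁ᵏ z^β` belong to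
the Drury–Arveson space `H²ₙ`. Then `z₂ (1-z₁²)^{-1/4} f_β ∈ H²ₙ` with
`‖z₂ (1-z₁²)^{-1/4} f_β‖² ≤ 2 ‖f_β‖²`. -/
theorem stmt_15 (n : ℕ) (hn : 2 ≤ n) (β : Fin n →₀ ℕ)
    (hβ0 : β ⟨0, by omega⟩ = 0) (hβ : 1 ≤ mdeg β)
    (f : EuclideanSpace ℂ (Fin n) → ℂ) (A : (Fin n →₀ ℕ) → ℂ)
    (hsupp : ∀ α, A α ≠ 0 → ∃ k : ℕ, α = β + Finsupp.single ⟨0, by omega⟩ k)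
    (hexp : IsExpansion A f) (hmem : MemDA A) :
    ∃ B : (Fin n →₀ ℕ) → ℂ,
      IsExpansion B (fun z =>
        z ⟨1, by omega⟩ * (1 - z ⟨0, by omega⟩ ^ 2) ^ (-(1 / 4) : ℂ) * f z) ∧
      MemDA B ∧ daNormSq B ≤ 2 * daNormSq A := by
  set i0 : Fin n := ⟨0, by omega⟩ with hi0
  set i1 : Fin n := ⟨1, by omega⟩ with hi1
  have h01 : i0 ≠ i1 := by simp [hi0, hi1]
  obtain ⟨m, hm⟩ : ∃ m, mdeg β = m + 1 := ⟨mdeg β - 1, by omega⟩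
  set γ : Fin n →₀ ℕ := β + Finsupp.single i1 1 with hγ
  have hγ0 : γ i0 = 0 := by simp [hγ, hβ0, h01.symm]
  have hγm : mdeg γ = (m + 1) + 1 := by rw [hγ, mdeg_add_single, hm]
  have hβi := extend_tools β i0
  have hγi := extend_tools γ i0
  have hA0 : ∀ α ∉ Set.range (fun k : ℕ => β + Finsupp.single i0 k), A α = 0 := by
    intro α hα
    by_contra h
    obtain ⟨k, hk⟩ := hsupp α h
    exact hα ⟨k, hk.symm⟩
  set a : ℕ → ℂ := fun k => A (β + Finsupp.single i0 k) with ha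
  set b : ℕ → ℂ := fun k =>
    ∑ p ∈ Finset.HasAntidiagonal.antidiagonal k, (ccoef p.1 : ℂ) * a p.2 with hb
  set B : (Fin n →₀ ℕ) → ℂ := Function.extend (fun k : ℕ => γ + Finsupp.single i0 k) b 0 with hB
  have hBa : ∀ k, B (γ + Finsupp.single i0 k) = b k := fun k => hγi.extend_apply b 0 k
  have hB0 : ∀ α ∉ Set.range (fun k : ℕ => γ + Finsupp.single i0 k), B α = 0 :=
    fun α hα => Function.extend_apply' _ _ _ hα
  have hfγ : mfact γ = (β i1 + 1) * mfact β := by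
    have h := mfact_add_single β i1 1
    rw [Nat.factorial_succ, mul_assoc, mul_comm (β i1).factorial, ← mul_assoc] at h
    exact Nat.eq_of_mul_eq_mul_right (Nat.factorial_pos _) h
  -- the norms
  have hAs : Summable (fun k => ‖a k‖ ^ 2 * daWeight (β + Finsupp.single i0 k)) :=
    (hβi.summable_iff (f := fun α => ‖A α‖ ^ 2 * daWeight α)
      (fun α hα => by simp [hA0 α hα])).2 hmem
  have hAt : daNormSq A = ∑' k, ‖a k‖ ^ 2 * daWeight (β + Finsupp.single i0 k) := by
    refine (hβi.tsum_eq (f := fun α => ‖A α‖ ^ 2 * daWeight α) ?_).symm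
    intro α hα
    by_contra h
    exact hα (by simp [hA0 α h])
  have hBt : daNormSq B = ∑' k, ‖b k‖ ^ 2 * daWeight (γ + Finsupp.single i0 k) := by
    simp_rw [← hBa]
    refine (hγi.tsum_eq (f := fun α => ‖B α‖ ^ 2 * daWeight α) ?_).symm
    intro α hα
    by_contra h
    exact hα (by simp [hB0 α h])
  have hMB : MemDA B ↔ Summable (fun k => ‖b k‖ ^ 2 * daWeight (γ + Finsupp.single i0 k)) := by
    simp_rw [← hBa]
    exact (hγi.summable_iff (f := fun α => ‖B α‖ ^ 2 * daWeight α)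
      (fun α hα => by simp [hB0 α hα])).symm
  have hfβ : 0 < mfact β := by
    unfold mfact
    exact Finset.prod_pos fun i _ => Nat.factorial_pos _
  have hfβ' : (0 : ℝ) < mfact β := by exact_mod_cast hfβ
  simp_rw [daWeight_add_single β i0 hβ0 m hm] at hAs hAt
  simp_rw [daWeight_add_single γ i0 hγ0 (m + 1) hγm] at hBt hMB
  have hcA : (0 : ℝ) < (mfact β : ℝ) / m.factorial := by positivity
  set cA : ℝ := (mfact β : ℝ) / m.factorial with hcAdef
  set cB : ℝ := (mfact γ : ℝ) / (m + 1).factorial with hcBdef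
  have hcB0 : 0 ≤ cB := by positivity
  have hcB : cB ≤ 2 * cA := by
    rw [hcBdef, hcAdef, hfγ, Nat.factorial_succ]
    have hle : ((β i1 : ℕ) : ℝ) ≤ m + 1 := by
      have := le_mdeg β i1
      rw [hm] at this
      exact_mod_cast this
    have hmf : (0 : ℝ) < m.factorial := by positivity
    push_cast
    rw [div_le_iff₀ (by positivity)]
    have : 2 * ((mfact β : ℝ) / m.factorial) * ((m + 1) * m.factorial) =
      2 * (m + 1) * mfact β := by field_simp
    rw [this]
    exact mul_le_mul_of_nonneg_right (by linarith [(Nat.cast_nonneg m : (0 : ℝ) ≤ m)]) hfβ'.le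
  have hAs' : Summable fun k =>
      ‖a k‖ ^ 2 * ((k.factorial * m.factorial : ℝ) / (k + m + 1).factorial) := by
    refine (summable_mul_left_iff hcA.ne').1 (hAs.congr fun k => ?_)
    ring
  obtain ⟨hS, hle⟩ := core_real (fun k => ‖a k‖) m hAs'
  have hbk : ∀ k, ‖b k‖ ≤
      ∑ p ∈ Finset.HasAntidiagonal.antidiagonal k, ccoef p.1 * ‖a p.2‖ := by
    intro k
    refine (norm_sum_le _ _).trans (le_of_eq (Finset.sum_congr rfl fun p _ => ?_))
    rw [norm_mul, Complex.norm_real, Real.norm_of_nonneg (ccoef_nonneg _)]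
  have hbk2 : ∀ k, ‖b k‖ ^ 2 *
      ((k.factorial * (m + 1).factorial : ℝ) / (k + (m + 1) + 1).factorial) ≤
      (∑ p ∈ Finset.HasAntidiagonal.antidiagonal k, ccoef p.1 * ‖a p.2‖) ^ 2 *
      ((k.factorial * (m + 1).factorial : ℝ) / (k + (m + 1) + 1).factorial) := by
    intro k
    have := hbk k
    gcongr
  have hbS : Summable fun k => ‖b k‖ ^ 2 *
      ((k.factorial * (m + 1).factorial : ℝ) / (k + (m + 1) + 1).factorial) :=
    Summable.of_nonneg_of_le (fun k => by positivity) hbk2 hS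
  refine ⟨B, ?_, ?_, ?_⟩
  · intro z hz
    have hz0 : ‖z i0‖ < 1 := lt_of_le_of_lt (PiLp.norm_apply_le z i0) (by simpa using hz)
    have h1 := ccoef_hasSum (z i0) hz0
    have h2 : HasSum (fun k => a k * z i0 ^ k * mon β z) (f z) := by
      have h := (hβi.hasSum_iff (f := fun α => A α * mon α z)
        (fun α hα => by simp [hA0 α hα])).2 (hexp z hz)
      convert h using 2 with k
      simp only [Function.comp_apply, ha, mon_add, mon_single]
      ring
    have h3 : HasSum (fun k => b k * mon (γ + Finsupp.single i0 k) z)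
        (z i1 * (1 - z i0 ^ 2) ^ (-(1 / 4) : ℂ) * f z) := by
      have hs := (summable_norm_sum_mul_antidiagonal_of_summable_norm h1.summable.norm
        h2.summable.norm).of_norm.hasSum
      rw [← tsum_mul_tsum_eq_tsum_sum_antidiagonal_of_summable_norm h1.summable.norm
        h2.summable.norm, h1.tsum_eq, h2.tsum_eq] at hs
      have hs := hs.mul_left (z i1)
      rw [← mul_assoc] at hs
      refine (congrArg (fun g => HasSum g _) (funext fun k => ?_)).mpr hs
      simp only [hb, hγ, mon_add, mon_single, pow_one]
      rw [Finset.sum_mul, Finset.mul_sum]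
      refine Finset.sum_congr rfl fun p hp => ?_
      rw [← Finset.HasAntidiagonal.mem_antidiagonal.1 hp, pow_add]
      ring
    refine (hγi.hasSum_iff (f := fun α => B α * mon α z)
        (fun α hα => by simp [hB0 α hα])).1 ?_
    simpa only [Function.comp_def, hBa] using h3
  · rw [hMB]
    exact (hbS.mul_left cB).congr fun k => by ring
  · rw [hBt, hAt]
    have e1 : ∀ (c x y : ℝ), x * (c * y) = c * (x * y) := fun c x y => by ring
    simp_rw [e1 cA, e1 cB]
    rw [tsum_mul_left, tsum_mul_left]
    have h1 := (hbS.tsum_le_tsum hbk2 hS).trans hle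
    calc _ ≤ cB * _ := mul_le_mul_of_nonneg_left h1 hcB0
      _ ≤ (2 * cA) * _ := mul_le_mul_of_nonneg_right hcB (tsum_nonneg fun k => by positivity)
      _ = _ := by ring
end

section
/- A commutative unital ring R is coherent if and only if (a) the intersection of any two finitely generated ideals of R is finitely generated, and (b) the annihilator of every element of R is a finitely generated ideal. -/
theorem coh_congr {R M : Type*} [CommRing R] [AddCommGroup M] [Module R M]
    {N N' : Submodule R M} (h : N'.FG) (e : N = N') : N.FG := e ▸ h

theorem coh_step {R M : Type*} [CommRing R] [AddCommGroup M] [Module R M] [Module.Finite R M]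
    (hI : ∀ I J : Ideal R, I.FG → J.FG → (I ⊓ J).FG)
    (hA : ∀ a : R, (LinearMap.ker (LinearMap.toSpanSingleton R R a)).FG)
    (a : R) (ψ : M →ₗ[R] R) (hψ : (LinearMap.ker ψ).FG) :
    (LinearMap.ker ((LinearMap.toSpanSingleton R R a).coprod ψ)).FG := by
  have hJ : (LinearMap.range ψ).FG := Module.Finite.fg_top.map ψ |> fun h => by
    rwa [Submodule.map_top] at h
  apply Submodule.fg_of_fg_map_of_fg_inf_ker (LinearMap.fst R R M)
  · apply Submodule.fg_of_fg_map_of_fg_inf_ker (LinearMap.toSpanSingleton R R a)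
    · refine coh_congr (hI (Ideal.span {a}) (LinearMap.range ψ) (Submodule.fg_span_singleton a) hJ) ?_
      ext x
      simp only [Submodule.mem_map, LinearMap.mem_ker, LinearMap.coprod_apply, Submodule.mem_inf,
        Ideal.mem_span_singleton', LinearMap.mem_range, LinearMap.toSpanSingleton_apply,
        smul_eq_mul, LinearMap.fst_apply, Prod.exists]
      constructor
      · rintro ⟨r, ⟨s, m, h, rfl⟩, rfl⟩
        exact ⟨⟨s, rfl⟩, -m, by rw [map_neg]; linear_combination -h⟩
      · rintro ⟨⟨r, rfl⟩, m, hm⟩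
        exact ⟨r, ⟨r, -m, by rw [map_neg, hm]; ring, rfl⟩, rfl⟩
    · refine coh_congr (hA a) ?_
      rw [inf_eq_right]
      intro r hr
      exact ⟨(r, 0), by simpa using hr, rfl⟩
  · refine coh_congr (hψ.map (LinearMap.inr R R M)) ?_
    ext ⟨r, m⟩
    simp only [Submodule.mem_map, LinearMap.mem_ker, LinearMap.coprod_apply, Submodule.mem_inf,
        LinearMap.toSpanSingleton_apply, smul_eq_mul, LinearMap.fst_apply, LinearMap.inr_apply,
        Prod.mk.injEq]
    constructor
    · rintro ⟨h, rfl⟩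
      exact ⟨m, by simpa using h, rfl, rfl⟩
    · rintro ⟨m, h, rfl, rfl⟩
      exact ⟨by simpa using h, rfl⟩

theorem coh_all {R : Type*} [CommRing R]
    (hI : ∀ I J : Ideal R, I.FG → J.FG → (I ⊓ J).FG)
    (hA : ∀ a : R, (LinearMap.ker (LinearMap.toSpanSingleton R R a)).FG)
    (n : ℕ) (φ : (Fin n → R) →ₗ[R] R) : (LinearMap.ker φ).FG := by
  induction n with
  | zero =>
    rw [Subsingleton.elim (LinearMap.ker φ) ⊥]
    exact Submodule.fg_bot
  | succ n ih =>
    let e : (R × (Fin n → R)) ≃ₗ[R] (Fin (n + 1) → R) :=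
      Fin.consLinearEquiv R (fun _ : Fin (n + 1) => R)
    let θ : (R × (Fin n → R)) →ₗ[R] R := φ ∘ₗ e.toLinearMap
    have h := coh_step hI hA (θ (1, 0)) (θ ∘ₗ LinearMap.inr R R (Fin n → R)) (ih _)
    have h2 : (LinearMap.toSpanSingleton R R (θ (1, 0))).coprod
        (θ ∘ₗ LinearMap.inr R R (Fin n → R)) = θ := by
      apply LinearMap.prod_ext
      · ext; simp
      · ext; simp
    rw [h2] at h
    refine coh_congr (h.map e.toLinearMap) ?_
    ext x
    simp only [Submodule.mem_map, LinearMap.mem_ker]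
    constructor
    · intro hx
      exact ⟨e.symm x, by simpa [θ] using hx, by simp⟩
    · rintro ⟨y, hy, rfl⟩
      exact hy

theorem stmt_19 (R : Type*) [CommRing R] :
    (∀ (n : ℕ) (f : Fin n → R) (φ : (Fin n → R) →ₗ[R] R),
        (∀ g : Fin n → R, φ g = ∑ i, g i * f i) → (LinearMap.ker φ).FG) ↔
      ((∀ I J : Ideal R, I.FG → J.FG → (I ⊓ J).FG) ∧
        ∀ a : R, (LinearMap.ker (LinearMap.toSpanSingleton R R a)).FG) := by
  constructor
  · intro H
    refine ⟨fun I J hI hJ => ?_, fun a => ?_⟩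
    · obtain ⟨m, a, rfl⟩ := Submodule.fg_iff_exists_fin_generating_family.1 hI
      obtain ⟨k, b, rfl⟩ := Submodule.fg_iff_exists_fin_generating_family.1 hJ
      have h := H (m + k) (Fin.append a b) (Fintype.linearCombination R (Fin.append a b))
        (fun g => by simp [Fintype.linearCombination_apply])
      refine coh_congr (h.map (Fintype.linearCombination R a ∘ₗ
        LinearMap.funLeft R R (Fin.castAdd k))) ?_
      ext x
      simp only [Submodule.mem_inf, Submodule.mem_map, LinearMap.mem_ker, LinearMap.comp_apply,
        Fintype.linearCombination_apply, Fin.sum_univ_add, Fin.append_left, Fin.append_right,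
        LinearMap.funLeft_apply, Submodule.mem_span_range_iff_exists_fun]
      constructor
      · rintro ⟨⟨c, hc⟩, d, hd⟩
        refine ⟨Fin.append c (-d), ?_, ?_⟩
        · simp only [Fin.append_left, Fin.append_right, Pi.neg_apply, neg_smul,
            Finset.sum_neg_distrib, hc, hd, add_neg_cancel]
        · simpa using hc
      · rintro ⟨g, hg, rfl⟩
        refine ⟨⟨fun i => g (Fin.castAdd k i), rfl⟩, fun i => - g (Fin.natAdd m i), ?_⟩
        simp only [neg_smul, Finset.sum_neg_distrib]
        exact (eq_neg_of_add_eq_zero_left hg).symm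
    · have h := H 1 (fun _ => a) (Fintype.linearCombination R (fun _ => a))
        (fun g => by simp [Fintype.linearCombination_apply])
      refine coh_congr (h.map (LinearMap.proj (R := R) (φ := fun _ : Fin 1 => R) 0)) ?_
      ext x
      simp only [Submodule.mem_map, LinearMap.mem_ker, Fintype.linearCombination_apply,
        LinearMap.toSpanSingleton_apply, Fin.sum_univ_one, LinearMap.proj_apply]
      constructor
      · intro hx
        exact ⟨fun _ => x, hx, rfl⟩
      · rintro ⟨g, hg, rfl⟩
        exact hg
  · rintro ⟨hI, hA⟩ n f φ -
    exact coh_all hI hA n φ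
end
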